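/- arXiv:2408.04907 — 3 statements merged into one kernel-verified Lean document; each statement's English description precedes it below -/
import Mathlib

section
/- Let q ≥ 1 and let k1 ≤ k2 be positive integers. For parameters β_1,…,β_q ∈ ℝ and ω_{k,j} ∈ ℝ (k1 ≤ k ≤ k2, j ∈ {1,…,q}), define the real matrix A whose rows are indexed by pairs (k,r) with k1 ≤ k ≤ k2 and 0 ≤ r ≤ k − k1, whose columns are indexed by c ∈ {0,1,…,k1−1}, and whose entries are A_{(k,r),c} = Σ_{j=1}^{q} ω_{k,j} β_j^{r+c}. Let R = Σ_{k=k1}^{k2} (k − k1 + 1) be the number of rows. Then for Lebesgue-almost every choice of the parameter vector ((ω_{k,j}), (β_j)) ∈ ℝ^{q(k2−k1+1)} × ℝ^q, the matrix A has rank exactly min(q, R, k1). -/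
open MeasureTheory

/-- A real analytic function on a finite-dimensional real vector space which does not vanish
identically is nonzero almost everywhere. -/
theorem AnalyticOnNhd.ae_ne_zero {E : Type*} [NormedAddCommGroup E] [NormedSpace ℝ E]
    [FiniteDimensional ℝ E] [MeasurableSpace E] [BorelSpace E] (μ : Measure E)
    [μ.IsAddHaarMeasure] {f : E → ℝ} (hf : AnalyticOnNhd ℝ f Set.univ) {x₀ : E}
    (hx₀ : f x₀ ≠ 0) : ∀ᵐ x ∂μ, f x ≠ 0 := by
  have hcont : Continuous f := continuousOn_univ.1 hf.continuousOn
  have hline : ∀ y : E, ∀ᵐ t : ℝ, f (x₀ + t • y) ≠ 0 := by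
    intro y
    have hg : AnalyticOnNhd ℝ (fun t : ℝ => f (x₀ + t • y)) Set.univ := by
      intro t _
      exact (hf (x₀ + t • y) trivial).fun_comp (f := fun t : ℝ => x₀ + t • y) (by fun_prop)
    have hcod := hg.preimage_zero_mem_codiscreteWithin (x := 0) (by simpa using hx₀) trivial
      isConnected_univ
    simpa only [Measure.restrict_univ] using!
      ae_restrict_le_codiscreteWithin (μ := volume) MeasurableSet.univ hcod
  have hmeas : MeasurableSet {p : E × ℝ | f (x₀ + p.2 • p.1) ≠ 0} :=
    (isOpen_ne.preimage (f := fun p : E × ℝ => f (x₀ + p.2 • p.1)) (by fun_prop)).measurableSet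
  have hswap : ∀ᵐ t : ℝ, ∀ᵐ y ∂μ, f (x₀ + t • y) ≠ 0 :=
    (Measure.ae_ae_comm (p := fun y t => f (x₀ + t • y) ≠ 0) hmeas).1 (ae_of_all μ hline)
  obtain ⟨t, ht, ht0⟩ := (hswap.and (Measure.ae_ne volume (0 : ℝ))).exists
  have hscale : μ ((t • ·) ⁻¹' {z | f (x₀ + z) = 0}) = 0 := by
    simpa [ae_iff] using ht
  rw [Measure.addHaar_preimage_smul μ ht0] at hscale
  have hpos : ENNReal.ofReal |(t ^ Module.finrank ℝ E)⁻¹| ≠ 0 := by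
    simp [ht0]
  have hshift := (mul_eq_zero.1 hscale).resolve_left hpos
  have : μ ((x₀ + ·) ⁻¹' {z | f z = 0}) = 0 := hshift
  rw [measure_preimage_add] at this
  simpa [ae_iff] using this

/-- If the first `#s` power sums of distinct nodes indexed by `s`, with weights `w`, vanish, then
the weights vanish. -/
theorem Finset.eq_zero_of_forall_sum_mul_pow_eq_zero {ι K : Type*} [CommRing K] [IsDomain K]
    {s : Finset ι} {x w : ι → K} (hx : Set.InjOn x s)
    (h : ∀ r < s.card, ∑ j ∈ s, w j * x j ^ r = 0) {j : ι} (hj : j ∈ s) : w j = 0 := by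
  have hinj : Function.Injective fun i => x (s.equivFin.symm i) := fun a b hab =>
    s.equivFin.symm.injective (Subtype.ext (hx (Subtype.prop _) (Subtype.prop _) hab))
  have key := Matrix.eq_zero_of_forall_pow_sum_mul_pow_eq_zero (v := fun i => w (s.equivFin.symm i))
    hinj fun r => by
      rw [s.equivFin.symm.sum_comp fun i : s => w i * x i ^ (r : ℕ),
        Finset.sum_coe_sort s fun i => w i * x i ^ (r : ℕ)]
      exact h r r.2
  simpa using congrFun key (s.equivFin ⟨j, hj⟩)

/-- The matrix of weighted power sums `∑ j, ω_{k,j} β_j ^ (r + c)`, with `r ≤ k`. -/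
def stackedPowerSumMatrix {n q m : ℕ} (ω : Fin n → Fin q → ℝ) (β : Fin q → ℝ) :
    Matrix (Σ k : Fin n, Fin (k.1 + 1)) (Fin m) ℝ :=
  Matrix.of fun kr c => ∑ j, ω kr.1 j * β j ^ (kr.2.1 + c.1)

theorem rank_stackedPowerSumMatrix_le {n q m : ℕ} (ω : Fin n → Fin q → ℝ) (β : Fin q → ℝ) :
    (stackedPowerSumMatrix (m := m) ω β).rank ≤ q := by
  have h : stackedPowerSumMatrix (m := m) ω β =
      (Matrix.of fun (kr : Σ k : Fin n, Fin (k.1 + 1)) j => ω kr.1 j * β j ^ kr.2.1) *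
        (Matrix.of fun (j : Fin q) (c : Fin m) => β j ^ c.1) := by
    ext kr c
    simp [stackedPowerSumMatrix, Matrix.mul_apply, pow_add, mul_assoc]
  rw [h]
  exact (Matrix.rank_mul_le_left _ _).trans ((Matrix.rank_le_card_width _).trans_eq (Fintype.card_fin q))

theorem exists_injective_stackedPowerSumMatrix {n q m : ℕ} (hq : m ≤ q)
    (hR : m ≤ Fintype.card (Σ k : Fin n, Fin (k.1 + 1))) :
    ∃ (ω : Fin n → Fin q → ℝ) (β : Fin q → ℝ),
      Function.Injective (stackedPowerSumMatrix (m := m) ω β).mulVec := by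
  classical
  let e := Fintype.equivFin (Σ k : Fin n, Fin (k.1 + 1))
  let J : Fin n → Finset (Fin q) := fun k =>
    {j | ∃ r : Fin (k.1 + 1), (e ⟨k, r⟩ : ℕ) = j}
  have hJcard : ∀ k, (J k).card ≤ k.1 + 1 := by
    intro k
    calc (J k).card = ((J k).map Fin.valEmbedding).card := (Finset.card_map _).symm
      _ ≤ (Finset.univ.image fun r : Fin (k.1 + 1) => (e ⟨k, r⟩ : ℕ)).card := by
          refine Finset.card_le_card fun i hi => ?_
          simp only [J, Finset.mem_map, Finset.mem_filter, Finset.mem_univ, true_and] at hi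
          obtain ⟨j, ⟨r, hr⟩, rfl⟩ := hi
          exact Finset.mem_image.2 ⟨r, Finset.mem_univ _, hr⟩
      _ ≤ k.1 + 1 := Finset.card_image_le.trans (by simp)
  have hβ : Function.Injective fun j : Fin q => ((j : ℕ) : ℝ) :=
    Nat.cast_injective.comp Fin.val_injective
  refine ⟨fun k j => if j ∈ J k then 1 else 0, fun j => (j : ℕ), ?_⟩
  rw [← Matrix.coe_mulVecLin, injective_iff_map_eq_zero]
  intro v hv
  let w : Fin q → ℝ := fun j => ∑ c, v c * ((j : ℕ) : ℝ) ^ c.1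
  have hw : ∀ k, ∀ j ∈ J k, w j = 0 := by
    intro k j hj
    refine Finset.eq_zero_of_forall_sum_mul_pow_eq_zero (w := w) hβ.injOn (fun r hr => ?_) hj
    have hkr := congrFun hv ⟨k, r, hr.trans_le (hJcard k)⟩
    simp only [Matrix.mulVecLin_apply, Matrix.mulVec, dotProduct, stackedPowerSumMatrix,
      Matrix.of_apply, Pi.zero_apply, ite_mul, one_mul, zero_mul, Finset.sum_ite_mem,
      Finset.univ_inter, Finset.sum_mul] at hkr
    rw [Finset.sum_comm] at hkr
    rw [← hkr]
    refine Finset.sum_congr rfl fun j _ => ?_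
    rw [Finset.sum_mul]
    exact Finset.sum_congr rfl fun c _ => by ring
  refine Matrix.eq_zero_of_forall_index_sum_mul_pow_eq_zero
    (hβ.comp (Fin.castLE_injective hq)) fun j => ?_
  let s := e.symm (Fin.castLE hR j)
  refine hw s.1 (Fin.castLE hq j) (Finset.mem_filter.2 ⟨Finset.mem_univ _, s.2, ?_⟩)
  simp [s]

theorem ae_le_rank_stackedPowerSumMatrix {n q m N : ℕ} (hq : N ≤ q) (hm : N ≤ m)
    (hR : N ≤ Fintype.card (Σ k : Fin n, Fin (k.1 + 1))) :
    ∀ᵐ p : (Fin n → Fin q → ℝ) × (Fin q → ℝ),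
      N ≤ (stackedPowerSumMatrix (m := m) p.1 p.2).rank := by
  let C : (Fin n → Fin q → ℝ) × (Fin q → ℝ) → Matrix (Σ k : Fin n, Fin (k.1 + 1)) (Fin N) ℝ :=
    fun p => stackedPowerSumMatrix p.1 p.2
  have hω : ∀ k j, AnalyticOnNhd ℝ
      (fun p : (Fin n → Fin q → ℝ) × (Fin q → ℝ) => p.1 k j) Set.univ := fun k j =>
    ((ContinuousLinearMap.proj j).comp ((ContinuousLinearMap.proj k).comp
      (ContinuousLinearMap.fst ℝ (Fin n → Fin q → ℝ) (Fin q → ℝ)))).analyticOnNhd _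
  have hβ : ∀ j, AnalyticOnNhd ℝ
      (fun p : (Fin n → Fin q → ℝ) × (Fin q → ℝ) => p.2 j) Set.univ := fun j =>
    ((ContinuousLinearMap.proj j).comp
      (ContinuousLinearMap.snd ℝ (Fin n → Fin q → ℝ) (Fin q → ℝ))).analyticOnNhd _
  have hC : ∀ kr c, AnalyticOnNhd ℝ (fun p => C p kr c) Set.univ := fun kr c => by
    simp only [C, stackedPowerSumMatrix, Matrix.of_apply]
    exact Finset.analyticOnNhd_fun_sum _ fun j _ p hp =>
      (hω kr.1 j p hp).fun_mul ((hβ j p hp).fun_pow _)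
  have hdet : AnalyticOnNhd ℝ (fun p => ((C p).transpose * C p).det) Set.univ := by
    simp only [Matrix.det_apply', Matrix.mul_apply, Matrix.transpose_apply]
    exact Finset.analyticOnNhd_fun_sum _ fun σ _ => analyticOnNhd_const.mul
      (Finset.analyticOnNhd_fun_prod _ fun i _ =>
        Finset.analyticOnNhd_fun_sum _ fun kr _ => (hC kr _).mul (hC kr i))
  obtain ⟨ω, β, hinj⟩ := exists_injective_stackedPowerSumMatrix hq hR
  have hne : ((C (ω, β)).transpose * C (ω, β)).det ≠ 0 := by
    rw [Ne, ← Matrix.exists_mulVec_eq_zero_iff]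
    rintro ⟨v, hv0, hv⟩
    refine hv0 (hinj ?_)
    rw [Matrix.mulVec_zero]
    rw [← Matrix.mulVec_mulVec] at hv
    have h := congrArg (v ⬝ᵥ ·) hv
    rw [dotProduct_zero, Matrix.dotProduct_mulVec, Matrix.vecMul_transpose] at h
    exact dotProduct_self_eq_zero.1 h
  have : (volume : Measure ((Fin n → Fin q → ℝ) × (Fin q → ℝ))).IsAddHaarMeasure := by
    have := isAddHaarMeasure_volume_pi (Fin q)
    have : (volume : Measure (Fin n → Fin q → ℝ)).IsAddHaarMeasure :=
      Measure.pi.isAddHaarMeasure fun _ : Fin n => (volume : Measure (Fin q → ℝ))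
    exact Measure.prod.instIsAddHaarMeasure _ _
  filter_upwards [hdet.ae_ne_zero volume hne] with p hp
  have hrank := Matrix.rank_of_isUnit _ ((Matrix.isUnit_iff_isUnit_det _).2 hp.isUnit)
  calc N = ((C p).transpose * C p).rank := by rw [hrank, Fintype.card_fin]
    _ ≤ (C p).rank := Matrix.rank_mul_le_right _ _
    _ = ((stackedPowerSumMatrix (m := m) p.1 p.2).submatrix id (Fin.castLE hm)).rank := rfl
    _ ≤ _ := Matrix.rank_submatrix_le _ _ _

/-- Generic rank of the cumulant matrix `A^{(k1,…,k2)}_{1→2}`: for Lebesgue-almost every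
choice of the parameters `ω = (ω_{k,j})` and `β = (β_j)`, the matrix with rows indexed by
pairs `(k, r)` (with `k1 ≤ k ≤ k2`, `0 ≤ r ≤ k − k1`), columns `c ∈ {0, …, k1 − 1}`, and
entries `Σ_j ω_{k,j} β_j^{r+c}` has rank exactly `min(q, R, k1)`, where
`R = Σ_{k=k1}^{k2} (k − k1 + 1)` is the number of rows. -/
theorem cumulant_matrix_generic_rank
    (q k1 k2 : ℕ) (hq : 1 ≤ q) (hk1 : 1 ≤ k1) (hk12 : k1 ≤ k2)
    (R : ℕ) (hR : R = ∑ k ∈ Finset.Icc k1 k2, (k - k1 + 1)) :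
    ∀ᵐ param : (Fin (k2 - k1 + 1) → Fin q → ℝ) × (Fin q → ℝ) ∂volume,
      Matrix.rank
        (Matrix.of fun (kr : Σ k : Fin (k2 - k1 + 1), Fin (k.1 + 1)) (c : Fin k1) =>
          ∑ j, param.1 kr.1 j * param.2 j ^ (kr.2.1 + c.1))
        = min q (min R k1) := by
  have hcard : Fintype.card (Σ k : Fin (k2 - k1 + 1), Fin (k.1 + 1)) = R := by
    rw [hR, Fintype.card_sigma, ← Finset.Ico_succ_right_eq_Icc, Finset.sum_Ico_eq_sum_range,
      Finset.sum_range, Order.succ_eq_add_one]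
    have : k2 + 1 - k1 = k2 - k1 + 1 := by omega
    rw [this]
    simp
  filter_upwards [ae_le_rank_stackedPowerSumMatrix (n := k2 - k1 + 1) (q := q) (m := k1)
    (N := min q (min R k1)) (by omega) (by omega) (by omega)] with p hp
  refine le_antisymm (le_min (rank_stackedPowerSumMatrix_le p.1 p.2) (le_min ?_ ?_)) hp
  · exact (Matrix.rank_le_card_height _).trans hcard.le
  · exact (Matrix.rank_le_card_width _).trans_eq (Fintype.card_fin k1)
end

section
/- Let q ≥ 1 and let k1 ≤ k2 be positive integers. For β_1,…,β_q ∈ ℝ and ω_{k,j} ∈ ℝ (k1 ≤ k ≤ k2, j ∈ {1,…,q}), let A be the matrix with rows indexed by pairs (k,r), k1 ≤ k ≤ k2, 0 ≤ r ≤ k − k1, columns indexed by c ∈ {0,1,…,k1−1}, and entries A_{(k,r),c} = Σ_{j=1}^{q} ω_{k,j} β_j^{r+c}. For t ∈ ℝ, let Ã(t) be the matrix obtained from A by prepending the row (1, t, t^2, …, t^{k1−1}). Then for every i ∈ {1,…,q}, rank(Ã(β_i)) ≤ q; in particular, every (q+1) × (q+1) minor of Ã(β_i) vanishes. -/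
/-- A matrix that factors through `m` has rank at most the cardinality of `m`. -/
theorem Matrix.rank_mul_le_card {K n m l : Type*} [Field K] [Fintype m] [Fintype l]
    (B : Matrix n m K) (V : Matrix m l K) : (B * V).rank ≤ Fintype.card m :=
  (Matrix.rank_mul_le_right B V).trans V.rank_le_card_height

/-- A square matrix that factors through a smaller index type has zero determinant. -/
theorem Matrix.det_mul_eq_zero_of_card_lt {K n m : Type*} [Field K] [Fintype n] [DecidableEq n]
    [Fintype m] (B : Matrix n m K) (V : Matrix m n K) (h : Fintype.card m < Fintype.card n) :
    (B * V).det = 0 := by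
  by_contra hdet
  have hrank := Matrix.rank_of_isUnit (B * V)
    ((Matrix.isUnit_iff_isUnit_det _).2 (isUnit_iff_ne_zero.2 hdet))
  have := Matrix.rank_mul_le_card B V
  omega

/-- Extending the cumulant matrix `A^{(k1,…,k2)}_{1→2}` by the row `(1, t, …, t^{k1−1})`
with `t = β_i` for any source `i` does not increase the rank beyond `q`; in particular all
`(q+1) × (q+1)` minors of the extended matrix vanish. -/
theorem extended_cumulant_matrix_rank_le
    (q k1 k2 : ℕ) (hq : 1 ≤ q) (hk1 : 1 ≤ k1) (hk12 : k1 ≤ k2)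
    (β : Fin q → ℝ) (ω : Fin (k2 - k1 + 1) → Fin q → ℝ)
    (Atil : ℝ → Matrix (Option (Σ k : Fin (k2 - k1 + 1), Fin (k.1 + 1))) (Fin k1) ℝ)
    (hAtil : ∀ (t : ℝ) (i : Option (Σ k : Fin (k2 - k1 + 1), Fin (k.1 + 1))) (c : Fin k1),
      Atil t i c = i.elim (t ^ c.1) (fun kr => ∑ j, ω kr.1 j * β j ^ (kr.2.1 + c.1))) :
    ∀ i : Fin q,
      (Atil (β i)).rank ≤ q ∧
      ∀ (rs : Fin (q + 1) → Option (Σ k : Fin (k2 - k1 + 1), Fin (k.1 + 1)))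
        (cs : Fin (q + 1) → Fin k1),
        ((Atil (β i)).submatrix rs cs).det = 0 := by
  intro i
  let B : Matrix (Option (Σ k : Fin (k2 - k1 + 1), Fin (k.1 + 1))) (Fin q) ℝ :=
    fun r j => r.elim (if i = j then 1 else 0) (fun kr => ω kr.1 j * β j ^ kr.2.1)
  let V : Matrix (Fin q) (Fin k1) ℝ := fun j c => β j ^ c.1
  have hfac : Atil (β i) = B * V := by
    ext r c
    rw [hAtil, Matrix.mul_apply]
    cases r with
    | none => simp [B, V]
    | some kr => simp [B, V, pow_add, mul_assoc]
  rw [hfac]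
  refine ⟨by simpa using Matrix.rank_mul_le_card B V, fun rs cs => ?_⟩
  rw [Matrix.submatrix_mul B V rs id cs Function.bijective_id]
  exact Matrix.det_mul_eq_zero_of_card_lt _ _ (by simp)
end

section
/- Let q ≥ 1, set k1 = q + 1, and let k2 ≥ k1 be such that the number of rows R = Σ_{k=k1}^{k2}(k − k1 + 1) satisfies R ≥ q. For parameters β_1,…,β_q ∈ ℝ and ω_{k,j} ∈ ℝ (k1 ≤ k ≤ k2, j ∈ {1,…,q}), let A be the matrix with rows indexed by pairs (k,r), k1 ≤ k ≤ k2, 0 ≤ r ≤ k − k1, columns indexed by c ∈ {0,1,…,q}, and entries A_{(k,r),c} = Σ_{j=1}^{q} ω_{k,j} β_j^{r+c}, and for t ∈ ℝ let Ã(t) be A with row (1, t, …, t^q) prepended. Then for Lebesgue-almost every parameter vector ((ω_{k,j}), (β_j)) ∈ ℝ^{q(k2−k1+1)} × ℝ^q the following holds: for every choice of q rows of A, the determinant d(t) of the (q+1) × (q+1) submatrix of Ã(t) consisting of the prepended top row and these q rows, regarded as a polynomial in t of degree at most q, is not the zero polynomial and its real roots are exactly {β_1, …, β_q}. -/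
open MeasureTheory

/-- If a measurable function is nonzero at `x₀` and polynomial on every line through `x₀`, then it
is nonzero almost everywhere. -/
theorem ae_ne_zero_of_polynomial_on_lines {E : Type*} [NormedAddCommGroup E] [NormedSpace ℝ E]
    [FiniteDimensional ℝ E] [MeasurableSpace E] [BorelSpace E] (μ : Measure E)
    [μ.IsAddHaarMeasure] {f : E → ℝ} (hf : Measurable f) {x₀ : E} (hx₀ : f x₀ ≠ 0)
    (hpoly : ∀ v : E, ∃ p : Polynomial ℝ, ∀ t : ℝ, f (x₀ + t • v) = p.eval t) :
    ∀ᵐ x ∂μ, f x ≠ 0 := by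
  have hmeas : MeasurableSet {z : ℝ × E | f (x₀ + z.1 • z.2) ≠ 0} :=
    (hf.comp (by fun_prop : Measurable fun z : ℝ × E => x₀ + z.1 • z.2))
      (measurableSet_singleton (0 : ℝ)).compl
  have hlines : ∀ v : E, ∀ᵐ t : ℝ, f (x₀ + t • v) ≠ 0 := by
    intro v
    obtain ⟨p, hp⟩ := hpoly v
    have hp0 : p ≠ 0 := by
      rintro rfl
      exact hx₀ (by simpa using hp 0)
    have hfin : {t : ℝ | p.eval t = 0}.Finite :=
      Polynomial.finite_setOfPred_isRoot hp0
    filter_upwards [hfin.countable.ae_notMem volume] with t ht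
    rw [hp]
    exact ht
  have hae : ∀ᵐ t : ℝ, ∀ᵐ v ∂μ, f (x₀ + t • v) ≠ 0 :=
    (Measure.ae_ae_comm hmeas).2 (Filter.Eventually.of_forall hlines)
  obtain ⟨t, ht, ht0⟩ := (hae.and (Measure.ae_ne volume (0 : ℝ))).exists
  have hshift : ∀ᵐ y ∂μ, f (x₀ + y) ≠ 0 := by
    rw [ae_iff] at ht ⊢
    have hpre := Measure.addHaar_preimage_smul μ ht0 {y | ¬ f (x₀ + y) ≠ 0}
    rw [Set.preimage_ofPred_eq, ht] at hpre
    simpa [ht0] using hpre.symm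
  rw [ae_iff] at hshift ⊢
  rw [← measure_preimage_add μ x₀]
  exact hshift

/-- The matrix `ω_{k_i, j} * β_j ^ r_i` attached to a choice `(k_i, r_i)` of row labels. -/
def monomialMatrix {R : Type*} [CommRing R] {m q : ℕ} (rows : Fin q → Σ k : Fin m, Fin (k.1 + 1))
    (ω : Fin m → Fin q → R) (β : Fin q → R) : Matrix (Fin q) (Fin q) R :=
  Matrix.of fun i j => ω (rows i).1 j * β j ^ (rows i).2.1

theorem exists_det_monomialMatrix_mul_det_vandermonde_ne_zero {m q : ℕ}
    {rows : Fin q → Σ k : Fin m, Fin (k.1 + 1)} (hrows : Function.Injective rows) :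
    ∃ x : (Fin m → Fin q → ℝ) × (Fin q → ℝ),
      (monomialMatrix rows x.1 x.2).det * (Matrix.vandermonde x.2).det ≠ 0 := by
  have hpow : Function.Injective fun n : ℕ => (2 : ℝ) ^ n :=
    pow_right_injective₀ (by norm_num) (by norm_num)
  refine ⟨(fun k j => (2 ^ j.1) ^ (m * k.1), fun j => 2 ^ j.1), mul_ne_zero ?_ ?_⟩
  · have hV : monomialMatrix rows (fun k j => ((2 : ℝ) ^ j.1) ^ (m * k.1)) (fun j => 2 ^ j.1) =
        Matrix.vandermonde fun i => (2 : ℝ) ^ (m * (rows i).1.1 + (rows i).2.1) := by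
      ext i j
      simp only [monomialMatrix, Matrix.of_apply, Matrix.vandermonde_apply]
      rw [← pow_add, ← pow_mul, ← pow_mul, mul_comm]
    simp only [hV]
    rw [Matrix.det_vandermonde_ne_zero_iff]
    intro a b hab
    apply hrows
    have he := hpow hab
    have ha : (rows a).2.1 < m := by have := (rows a).1.2; have := (rows a).2.2; omega
    have hb : (rows b).2.1 < m := by have := (rows b).1.2; have := (rows b).2.2; omega
    have hr : (rows a).2.1 = (rows b).2.1 := by
      simpa [Nat.mul_add_mod, Nat.mod_eq_of_lt, ha, hb] using congrArg (· % m) he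
    have hk : (rows a).1.1 = (rows b).1.1 := by
      rw [hr] at he
      exact Nat.eq_of_mul_eq_mul_left (by omega) (Nat.add_right_cancel he)
    generalize rows a = u at *
    generalize rows b = v at *
    obtain ⟨⟨k, _⟩, ⟨r, _⟩⟩ := u
    obtain ⟨⟨k', _⟩, ⟨r', _⟩⟩ := v
    simp only at hr hk
    subst hr hk
    rfl
  · exact Matrix.det_vandermonde_ne_zero_iff.2 fun a b hab => Fin.ext (hpow hab)

theorem isAddHaarMeasure_volume_matrix_prod_vector (m q : ℕ) :
    (volume : Measure ((Fin m → Fin q → ℝ) × (Fin q → ℝ))).IsAddHaarMeasure := by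
  have : (volume : Measure (Fin m → Fin q → ℝ)).IsAddHaarMeasure :=
    Measure.pi.isAddHaarMeasure _
  exact Measure.prod.instIsAddHaarMeasure _ _

theorem ae_det_monomialMatrix_mul_det_vandermonde_ne_zero {m q : ℕ}
    {rows : Fin q → Σ k : Fin m, Fin (k.1 + 1)} (hrows : Function.Injective rows) :
    ∀ᵐ x : (Fin m → Fin q → ℝ) × (Fin q → ℝ),
      (monomialMatrix rows x.1 x.2).det * (Matrix.vandermonde x.2).det ≠ 0 := by
  obtain ⟨x₀, hx₀⟩ := exists_det_monomialMatrix_mul_det_vandermonde_ne_zero hrows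
  have := isAddHaarMeasure_volume_matrix_prod_vector m q
  let f (x : (Fin m → Fin q → ℝ) × (Fin q → ℝ)) : ℝ :=
    (monomialMatrix rows x.1 x.2).det * (Matrix.vandermonde x.2).det
  have hf : Continuous f := by
    refine Continuous.mul ?_ ?_ <;>
      refine Continuous.matrix_det (continuous_matrix fun i j => ?_)
    · simp only [monomialMatrix, Matrix.of_apply]
      fun_prop
    · simp only [Matrix.vandermonde_apply]
      fun_prop
  have hpoly (v : (Fin m → Fin q → ℝ) × (Fin q → ℝ)) :
      ∃ p : Polynomial ℝ, ∀ t : ℝ, f (x₀ + t • v) = p.eval t := by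
    let ω : Fin m → Fin q → Polynomial ℝ := fun k j =>
      Polynomial.C (x₀.1 k j) + Polynomial.X * Polynomial.C (v.1 k j)
    let β : Fin q → Polynomial ℝ := fun j =>
      Polynomial.C (x₀.2 j) + Polynomial.X * Polynomial.C (v.2 j)
    refine ⟨(monomialMatrix rows ω β).det * (Matrix.vandermonde β).det, fun t => ?_⟩
    rw [← Polynomial.coe_evalRingHom, map_mul, RingHom.map_det, RingHom.map_det]
    dsimp only [f]
    congr 2
    · ext i j
      simp [monomialMatrix, ω, β, mul_comm t]
    · ext i j
      simp [Matrix.vandermonde_apply, β, mul_comm t]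
  exact ae_ne_zero_of_polynomial_on_lines volume hf.measurable hx₀ hpoly

/-- The bordered cumulant matrix is a block-diagonal matrix times a Vandermonde matrix. -/
theorem det_bordered_eq {R : Type*} [CommRing R] {m q : ℕ}
    (rows : Fin q → Σ k : Fin m, Fin (k.1 + 1)) (ω : Fin m → Fin q → R) (β : Fin q → R) (t : R) :
    (Matrix.of fun (i c : Fin (q + 1)) =>
      Fin.cases (motive := fun _ => R) (t ^ c.1)
        (fun i' => ∑ j, ω (rows i').1 j * β j ^ ((rows i').2.1 + c.1)) i).det =
      (monomialMatrix rows ω β).det *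
        (Matrix.vandermonde (Fin.cons t β : Fin (q + 1) → R)).det := by
  let B : Matrix (Fin (q + 1)) (Fin (q + 1)) R := Matrix.of fun i k =>
    Fin.cases (motive := fun _ => R) (Fin.cases (motive := fun _ => R) 1 (fun _ => 0) k)
      (fun i' => Fin.cases (motive := fun _ => R) 0 (monomialMatrix rows ω β i') k) i
  have hB : B.det = (monomialMatrix rows ω β).det := by
    rw [Matrix.det_succ_row_zero, Fin.sum_univ_succ]
    simp only [B, Matrix.of_apply, Fin.cases_zero, Fin.cases_succ, mul_zero, zero_mul,
      Finset.sum_const_zero, add_zero, Fin.val_zero, pow_zero, one_mul]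
    rfl
  rw [← hB, ← Matrix.det_mul]
  congr 1
  ext i c
  rw [Matrix.mul_apply, Fin.sum_univ_succ]
  refine Fin.cases ?_ (fun i' => ?_) i
  · simp [B, Matrix.vandermonde_apply]
  · simp [B, Matrix.vandermonde_apply, monomialMatrix, pow_add, mul_assoc]

/-- Theorem 3.2: with `k1 = q + 1` and enough rows (`R ≥ q`), for Lebesgue-almost every
parameter vector `(ω, β)`, and for every injective choice of `q` rows of the cumulant matrix
`A^{(k1,…,k2)}_{1→2}`, the determinant `d(t)` of the `(q+1) × (q+1)` submatrix of `Ã(t)`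
consisting of the prepended row `(1, t, …, t^q)` and these `q` rows is not the zero
polynomial in `t`, and its real roots are exactly `{β_1, …, β_q}`. -/
theorem minor_roots_are_effects
    (q k2 : ℕ) (hq : 1 ≤ q) (hk2 : q + 1 ≤ k2)
    (R : ℕ) (hR : R = ∑ k ∈ Finset.Icc (q + 1) k2, (k - (q + 1) + 1)) (hRq : q ≤ R) :
    ∀ᵐ param : (Fin (k2 - (q + 1) + 1) → Fin q → ℝ) × (Fin q → ℝ) ∂volume,
      ∀ rows : Fin q → (Σ k : Fin (k2 - (q + 1) + 1), Fin (k.1 + 1)),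
        Function.Injective rows →
        (∃ t : ℝ,
          (Matrix.of fun (i c : Fin (q + 1)) =>
            Fin.cases (motive := fun _ => ℝ) (t ^ c.1)
              (fun i' => ∑ j, param.1 (rows i').1 j * param.2 j ^ ((rows i').2.1 + c.1))
              i).det ≠ 0) ∧
        {t : ℝ |
          (Matrix.of fun (i c : Fin (q + 1)) =>
            Fin.cases (motive := fun _ => ℝ) (t ^ c.1)
              (fun i' => ∑ j, param.1 (rows i').1 j * param.2 j ^ ((rows i').2.1 + c.1))
              i).det = 0} = Set.range param.2 := by
  rw [ae_all_iff]
  intro rows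
  by_cases hrows : Function.Injective rows
  swap
  · exact Filter.Eventually.of_forall fun _ h => absurd h hrows
  filter_upwards [ae_det_monomialMatrix_mul_det_vandermonde_ne_zero hrows] with x hx _
  obtain ⟨hC, hV⟩ := mul_ne_zero_iff.1 hx
  have hβ := Matrix.det_vandermonde_ne_zero_iff.1 hV
  have key (t : ℝ) : (Matrix.of fun (i c : Fin (q + 1)) =>
      Fin.cases (motive := fun _ => ℝ) (t ^ c.1)
        (fun i' => ∑ j, x.1 (rows i').1 j * x.2 j ^ ((rows i').2.1 + c.1)) i).det = 0 ↔
      t ∈ Set.range x.2 := by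
    rw [det_bordered_eq, mul_eq_zero, or_iff_right hC, ← not_iff_not, ← ne_eq,
      Matrix.det_vandermonde_ne_zero_iff, Fin.cons_injective_iff]
    exact and_iff_left hβ
  refine ⟨?_, Set.ext key⟩
  obtain ⟨t, ht⟩ := (Set.finite_range x.2).exists_notMem
  exact ⟨t, fun h => ht ((key t).1 h)⟩
end
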